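/- Let u₁, u₂, v₁, v₂ ∈ ℝ², let c₁, c₂ ∈ ℝ, and let s, t ∈ ℝ² with s ∉ {u₁, u₂} and t ∉ {v₁, v₂}. For i = 1, 2 define f_i(s', t') := ‖s' − u_i‖ + c_i + ‖t' − v_i‖ on ℝ² × ℝ² ≅ ℝ⁴. If there exist a line ℓ ⊆ ℝ⁴ through (s, t) and a neighborhood U ⊆ ℝ⁴ of (s, t) such that both f₁ and f₂ are constant on ℓ ∩ U, then the three points s, u₁, u₂ are collinear and the three points t, v₁, v₂ are collinear. -/

import Mathlib

section StrictConvex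

variable {E F : Type*} [NormedAddCommGroup E] [NormedAddCommGroup F]

theorem two_mul_norm_le_norm_add_add_norm_sub {G : Type*} [NormedAddCommGroup G]
    [NormedSpace ℝ G] (w a : G) : 2 * ‖w‖ ≤ ‖w + a‖ + ‖w - a‖ := by
  have h := norm_add_le (w + a) (w - a)
  rwa [show w + a + (w - a) = (2 : ℝ) • w by module, norm_smul, Real.norm_two] at h

theorem sameRay_add_sub_of_norm_add_norm_eq [NormedSpace ℝ E]
    [StrictConvexSpace ℝ E] [NormedSpace ℝ F] {w a : E} {z b : F}
    (hadd : ‖w + a‖ + ‖z + b‖ = ‖w‖ + ‖z‖) (hsub : ‖w - a‖ + ‖z - b‖ = ‖w‖ + ‖z‖) :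
    SameRay ℝ (w + a) (w - a) := by
  rw [sameRay_iff_norm_add, show w + a + (w - a) = (2 : ℝ) • w by module, norm_smul,
    Real.norm_two]
  linarith [two_mul_norm_le_norm_add_add_norm_sub w a,
    two_mul_norm_le_norm_add_add_norm_sub z b]

theorem exists_eq_smul_of_sameRay_add_sub {G : Type*} [AddCommGroup G] [Module ℝ G] {w a : G}
    (ha : a ≠ 0) (h : SameRay ℝ (w + a) (w - a)) : ∃ r : ℝ, w = r • a := by
  rcases h with h | h | ⟨p, q, hp, hq, h⟩
  · exact ⟨-1, by rw [neg_one_smul]; exact eq_neg_of_add_eq_zero_left h⟩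
  · exact ⟨1, by rw [one_smul]; exact sub_eq_zero.mp h⟩
  · have h' : (q - p) • w = (p + q) • a := by
      rw [show (q - p) • w = q • (w - a) + q • a - p • w by module, ← h]
      module
    have hqp : q - p ≠ 0 := by
      intro h0
      rw [h0, zero_smul, eq_comm, smul_eq_zero] at h'
      exact h'.elim (add_pos hp hq).ne' ha
    exact ⟨(q - p)⁻¹ * (p + q), by rw [mul_smul, ← h', inv_smul_smul₀ hqp]⟩

theorem eq_zero_of_norm_add_eq_of_norm_sub_eq [NormedSpace ℝ E] [StrictConvexSpace ℝ E] {w a : E}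
    (hadd : ‖w + a‖ = ‖w‖) (hsub : ‖w - a‖ = ‖w‖) : a = 0 := by
  have hray : SameRay ℝ (w + a) (w - a) :=
    sameRay_add_sub_of_norm_add_norm_eq (z := (0 : E)) (b := 0) (by simpa) (by simpa)
  have h := (sameRay_iff_of_norm_eq (hadd.trans hsub.symm)).mp hray
  rw [← sub_eq_zero, show w + a - (w - a) = (2 : ℝ) • a by module, smul_eq_zero] at h
  simpa using h

theorem ne_zero_of_norm_add_norm_eq [NormedSpace ℝ F] [StrictConvexSpace ℝ F]
    {w a : E} {z b : F} (hab : a ≠ 0 ∨ b ≠ 0)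
    (hadd : ‖w + a‖ + ‖z + b‖ = ‖w‖ + ‖z‖) (hsub : ‖w - a‖ + ‖z - b‖ = ‖w‖ + ‖z‖) :
    a ≠ 0 := by
  rintro rfl
  refine hab.elim (· rfl) fun hb ↦ hb ?_
  exact eq_zero_of_norm_add_eq_of_norm_sub_eq (by simpa using hadd) (by simpa using hsub)

theorem collinear_of_norm_add_norm_eq [NormedSpace ℝ E] [StrictConvexSpace ℝ E]
    [NormedSpace ℝ F] [StrictConvexSpace ℝ F] {s u₁ u₂ a : E} {z₁ z₂ b : F}
    (hab : a ≠ 0 ∨ b ≠ 0)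
    (hadd₁ : ‖s - u₁ + a‖ + ‖z₁ + b‖ = ‖s - u₁‖ + ‖z₁‖)
    (hsub₁ : ‖s - u₁ - a‖ + ‖z₁ - b‖ = ‖s - u₁‖ + ‖z₁‖)
    (hadd₂ : ‖s - u₂ + a‖ + ‖z₂ + b‖ = ‖s - u₂‖ + ‖z₂‖)
    (hsub₂ : ‖s - u₂ - a‖ + ‖z₂ - b‖ = ‖s - u₂‖ + ‖z₂‖) :
    Collinear ℝ {s, u₁, u₂} := by
  have ha := ne_zero_of_norm_add_norm_eq hab hadd₁ hsub₁
  obtain ⟨r₁, h₁⟩ := exists_eq_smul_of_sameRay_add_sub ha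
    (sameRay_add_sub_of_norm_add_norm_eq hadd₁ hsub₁)
  obtain ⟨r₂, h₂⟩ := exists_eq_smul_of_sameRay_add_sub ha
    (sameRay_add_sub_of_norm_add_norm_eq hadd₂ hsub₂)
  rw [collinear_iff_of_mem (p₀ := s) (by simp)]
  refine ⟨a, ?_⟩
  rintro p (rfl | rfl | rfl)
  · exact ⟨0, by simp⟩
  · exact ⟨-r₁, by rw [neg_smul, ← h₁, vadd_eq_add]; abel⟩
  · exact ⟨-r₂, by rw [neg_smul, ← h₂, vadd_eq_add]; abel⟩

end StrictConvex

theorem AffineSubspace.exists_ne_zero_add_sub_mem {V : Type*} [NormedAddCommGroup V]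
    [NormedSpace ℝ V] {ℓ : AffineSubspace ℝ V} {p : V} (hp : p ∈ ℓ)
    (hdim : Module.finrank ℝ ℓ.direction = 1) {U : Set V} (hU : U ∈ nhds p) :
    ∃ d : V, d ≠ 0 ∧ p + d ∈ (ℓ : Set V) ∩ U ∧ p - d ∈ (ℓ : Set V) ∩ U := by
  have := Module.nontrivial_of_finrank_pos (R := ℝ) (M := ℓ.direction) (by omega)
  obtain ⟨⟨d, hd⟩, hd0⟩ := exists_ne (0 : ℓ.direction)
  have hd0 : d ≠ 0 := fun h ↦ hd0 (Subtype.ext h)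
  have hadd : Filter.Tendsto (fun x : ℝ ↦ p + x • d) (nhds 0) (nhds p) :=
    Continuous.tendsto' (by fun_prop) _ _ (by simp)
  have hsub : Filter.Tendsto (fun x : ℝ ↦ p - x • d) (nhds 0) (nhds p) :=
    Continuous.tendsto' (by fun_prop) _ _ (by simp)
  have hev := ((hadd.eventually hU).and (hsub.eventually hU)).filter_mono
    (nhdsWithin_le_nhds (s := {0}ᶜ))
  obtain ⟨x, ⟨hxa, hxs⟩, hx⟩ := (hev.and self_mem_nhdsWithin).exists
  have hmem (r : ℝ) : p + r • d ∈ ℓ := by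
    rw [add_comm]
    exact AffineSubspace.vadd_mem_of_mem_direction (ℓ.direction.smul_mem r hd) hp
  refine ⟨x • d, smul_ne_zero hx hd0, ⟨hmem x, hxa⟩, ⟨?_, hxs⟩⟩
  simpa [sub_eq_add_neg] using hmem (-x)


/-- Let `u₁, u₂, v₁, v₂ ∈ ℝ²`, `c₁, c₂ ∈ ℝ`, and `s, t ∈ ℝ²` with
`s ∉ {u₁, u₂}` and `t ∉ {v₁, v₂}`.  For `i = 1, 2` define
`f i (s', t') = ‖s' - u i‖ + c i + ‖t' - v i‖` on `ℝ² × ℝ² ≅ ℝ⁴`.  If there exist a line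
`ℓ ⊆ ℝ⁴` (a 1-dimensional affine subspace) through `(s, t)` and a neighborhood `U` of
`(s, t)` such that both `f₁` and `f₂` are constant on `ℓ ∩ U`, then `s, u₁, u₂` are
collinear and `t, v₁, v₂` are collinear. -/
theorem stmt_9 (u₁ u₂ v₁ v₂ s t : EuclideanSpace ℝ (Fin 2)) (c₁ c₂ : ℝ)
    (hs₁ : s ≠ u₁) (hs₂ : s ≠ u₂) (ht₁ : t ≠ v₁) (ht₂ : t ≠ v₂)
    (f₁ f₂ : EuclideanSpace ℝ (Fin 2) × EuclideanSpace ℝ (Fin 2) → ℝ)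
    (hf₁ : ∀ p, f₁ p = ‖p.1 - u₁‖ + c₁ + ‖p.2 - v₁‖)
    (hf₂ : ∀ p, f₂ p = ‖p.1 - u₂‖ + c₂ + ‖p.2 - v₂‖)
    (ℓ : AffineSubspace ℝ (EuclideanSpace ℝ (Fin 2) × EuclideanSpace ℝ (Fin 2)))
    (hmem : (s, t) ∈ ℓ) (hdim : Module.finrank ℝ ℓ.direction = 1)
    (U : Set (EuclideanSpace ℝ (Fin 2) × EuclideanSpace ℝ (Fin 2)))
    (hU : U ∈ nhds (s, t))
    (hconst : ∀ p ∈ (ℓ : Set (EuclideanSpace ℝ (Fin 2) × EuclideanSpace ℝ (Fin 2))) ∩ U,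
      f₁ p = f₁ (s, t) ∧ f₂ p = f₂ (s, t)) :
    Collinear ℝ {s, u₁, u₂} ∧ Collinear ℝ {t, v₁, v₂} := by
  obtain ⟨⟨a, b⟩, hd, hadd, hsub⟩ := ℓ.exists_ne_zero_add_sub_mem hmem hdim hU
  have hab : a ≠ 0 ∨ b ≠ 0 := by
    contrapose! hd
    rw [hd.1, hd.2, Prod.mk_zero_zero]
  obtain ⟨hadd₁, hadd₂⟩ := hconst _ hadd
  obtain ⟨hsub₁, hsub₂⟩ := hconst _ hsub
  simp only [hf₁, hf₂, Prod.mk_add_mk, Prod.mk_sub_mk, add_sub_right_comm, sub_right_comm _ a,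
    sub_right_comm _ b] at hadd₁ hadd₂ hsub₁ hsub₂
  constructor
  · apply collinear_of_norm_add_norm_eq (z₁ := t - v₁) (z₂ := t - v₂) hab <;> linarith
  · apply collinear_of_norm_add_norm_eq (z₁ := s - u₁) (z₂ := s - u₂) hab.symm <;> linarith
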